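/- Consider the linear penalty φ(δ) = δ, so the penalty of a length vector is Σ_{i=1}^n p_i·l_i (up to the additive constant −l_min·Σ p_i). Assume n ≤ D^{l_max−1}. If there exists a length vector minimizing Σ_{i=1}^n p_i·l_i among feasible length vectors with entries in [l_min, l_max] whose maximum entry equals l_max, then there exists a length vector minimizing Σ_{i=1}^n p_i·l_i among feasible length vectors with entries in [l_min, l_max−1] whose maximum entry equals l_max−1. -/

import Mathlib

/-- The Kraft sum `κ(l) = Σ_{i=1}^n D^{−l_i}` of a length vector. -/
noncomputable def kraft (D n : ℕ) (l : ℕ → ℕ) : ℝ :=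
  ∑ i ∈ Finset.Icc 1 n, (D : ℝ) ^ (-(l i : ℤ))

/-- The linear penalty `Σ_{i=1}^n p_i·l_i` of a length vector. -/
noncomputable def linPenalty (n : ℕ) (p : ℕ → ℝ) (l : ℕ → ℕ) : ℝ :=
  ∑ i ∈ Finset.Icc 1 n, p i * (l i : ℝ)

theorem kraft_eq_sum_inv_pow (D n : ℕ) (l : ℕ → ℕ) :
    kraft D n l = ∑ i ∈ Finset.Icc 1 n, ((D : ℝ)⁻¹) ^ l i := by
  simp [kraft]

/-- A set of exponents above `m` weighs at most as much as the block of the same size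
directly above `m`. -/
theorem mul_sum_pow_add_pow_card_le {D r : ℝ} (hD : 1 ≤ D) (hr : 0 < r) (hDr : D * r = 1)
    (m : ℕ) (Y : Finset ℕ) (hY : ∀ e ∈ Y, m < e) :
    (D - 1) * ∑ e ∈ Y, r ^ e + r ^ (m + Y.card) ≤ r ^ m := by
  have hr1 : r ≤ 1 := by nlinarith
  induction Y using Finset.induction_on_max with
  | empty => simp
  | insert a s hs ih =>
    have has : a ∉ s := fun h => lt_irrefl _ (hs a h)
    have hcard : s.card ≤ a - m - 1 := by
      rw [← Nat.card_Ioo]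
      exact Finset.card_le_card fun e he =>
        Finset.mem_Ioo.2 ⟨hY e (Finset.mem_insert_of_mem he), hs e he⟩
    have hma := hY a (Finset.mem_insert_self _ _)
    have ih' := ih fun e he => hY e (Finset.mem_insert_of_mem he)
    rw [Finset.sum_insert has, Finset.card_insert_of_notMem has]
    have h1 : r ^ a ≤ r ^ (m + (s.card + 1)) :=
      pow_le_pow_of_le_one hr.le hr1 (by omega)
    have h2 : D * r ^ (m + (s.card + 1)) = r ^ (m + s.card) := by
      rw [← add_assoc, pow_succ]; linear_combination r ^ (m + s.card) * hDr
    nlinarith [mul_le_mul_of_nonneg_left h1 (sub_nonneg.2 hD)]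

theorem mul_sum_pow_add_pow_card_lt {D r : ℝ} (hD : 1 < D) (hr : 0 < r) (hDr : D * r = 1)
    {m H : ℕ} (Y : Finset ℕ) (hY : ∀ e ∈ Y, m < e) (hH : H ∈ Y) (hlt : m + Y.card < H) :
    (D - 1) * ∑ e ∈ Y, r ^ e + r ^ (m + Y.card) < r ^ m := by
  have hr1 : r < 1 := by nlinarith
  have h := mul_sum_pow_add_pow_card_le hD.le hr hDr m (Y.erase H)
    fun e he => hY e (Finset.mem_of_mem_erase he)
  have hc := Finset.card_erase_add_one hH
  rw [← Finset.add_sum_erase _ _ hH, ← hc]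
  rw [← hc] at hlt
  have h1 : r ^ H < r ^ (m + ((Y.erase H).card + 1)) :=
    pow_lt_pow_right_of_lt_one₀ hr hr1 hlt
  have h2 : D * r ^ (m + ((Y.erase H).card + 1)) = r ^ (m + (Y.erase H).card) := by
    rw [← add_assoc, pow_succ]; linear_combination r ^ (m + (Y.erase H).card) * hDr
  nlinarith [mul_lt_mul_of_pos_left h1 (sub_pos.2 hD)]

/-- A set of exponents below `l` weighs at least as much as the block of the same size
directly below `l`. -/
theorem pow_sub_card_le {D r : ℝ} (hD : 1 ≤ D) (hr : 0 < r) (hDr : D * r = 1)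
    (l : ℕ) (Y : Finset ℕ) (hY : ∀ e ∈ Y, e < l) :
    r ^ (l - Y.card) ≤ r ^ l + (D - 1) * r * ∑ e ∈ Y, r ^ e := by
  have hr1 : r ≤ 1 := by nlinarith
  induction Y using Finset.induction_on_min with
  | empty => simp
  | insert a s hs ih =>
    have has : a ∉ s := fun h => lt_irrefl _ (hs a h)
    have hcard : s.card ≤ l - a - 1 := by
      rw [← Nat.card_Ioo]
      exact Finset.card_le_card fun e he =>
        Finset.mem_Ioo.2 ⟨hs e he, hY e (Finset.mem_insert_of_mem he)⟩
    have hal := hY a (Finset.mem_insert_self _ _)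
    have ih' := ih fun e he => hY e (Finset.mem_insert_of_mem he)
    rw [Finset.sum_insert has, Finset.card_insert_of_notMem has]
    obtain ⟨k, hk⟩ : ∃ k, l - s.card = k + 1 := ⟨l - s.card - 1, by omega⟩
    have hk' : l - (s.card + 1) = k := by omega
    rw [hk] at ih'
    rw [hk']
    have h1 : r ^ k ≤ r ^ a := pow_le_pow_of_le_one hr.le hr1 (by omega)
    have h2 : D * r * r ^ k = r ^ k := by rw [hDr, one_mul]
    have h3 : 0 ≤ (D - 1) * r := mul_nonneg (sub_nonneg.2 hD) hr.le
    rw [pow_succ] at ih'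
    nlinarith [mul_le_mul_of_nonneg_left h1 h3]

/-- If all initial segments of a weighted count are divisible by the corresponding power of `D`,
then any smaller multiple of the top power is attained by a subcount, which may be chosen to use
the lowest digit. -/
theorem exists_le_sum_pow_mul_eq {D : ℕ} (hD : 0 < D) (b : ℕ → ℕ) (hb : 0 < b 0) (d : ℕ)
    (hdvd : ∀ k ≤ d, D ^ k ∣ ∑ i ∈ Finset.range k, D ^ i * b i) (t : ℕ)
    (ht : t * D ^ d ≤ ∑ i ∈ Finset.range d, D ^ i * b i) :
    ∃ c : ℕ → ℕ, (∀ i, c i ≤ b i) ∧ ∑ i ∈ Finset.range d, D ^ i * c i = t * D ^ d ∧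
      (0 < t → 0 < c 0) := by
  induction d generalizing t with
  | zero =>
    refine ⟨b, fun _ => le_rfl, ?_, fun _ => hb⟩
    simpa [eq_comm] using ht
  | succ d ih =>
    obtain ⟨q, hq⟩ := hdvd d (Nat.le_succ d)
    have hpos : 0 < D ^ d := pow_pos hD d
    rw [Finset.sum_range_succ, hq] at ht
    have ht' : t * D ≤ q + b d := by
      refine Nat.le_of_mul_le_mul_left ?_ hpos
      calc D ^ d * (t * D) = t * D ^ (d + 1) := by ring
        _ ≤ _ := ht
        _ = _ := by ring
    obtain ⟨c, hcb, hsum, hc0⟩ := ih (fun k hk => hdvd k (by omega)) (min (t * D) q) (by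
      rw [hq, mul_comm]; exact Nat.mul_le_mul_left _ (min_le_right _ _))
    refine ⟨Function.update c d (t * D - min (t * D) q), fun i => ?_, ?_, fun htp => ?_⟩
    · by_cases hi : i = d
      · subst hi; simp only [Function.update_self]; omega
      · simpa [hi] using hcb i
    · rw [Finset.sum_range_succ, Function.update_self]
      have : ∑ i ∈ Finset.range d, D ^ i * Function.update c d (t * D - min (t * D) q) i =
          ∑ i ∈ Finset.range d, D ^ i * c i := by
        refine Finset.sum_congr rfl fun i hi => ?_
        rw [Function.update_of_ne (Finset.mem_range.1 hi).ne]
      rw [this, hsum]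
      calc min (t * D) q * D ^ d + D ^ d * (t * D - min (t * D) q)
          = D ^ d * (min (t * D) q + (t * D - min (t * D) q)) := by ring
        _ = D ^ d * (t * D) := by rw [Nat.add_sub_cancel' (min_le_left _ _)]
        _ = t * D ^ (d + 1) := by ring
    · have htD : 0 < t * D := Nat.mul_pos htp hD
      rcases Nat.eq_zero_or_pos d with rfl | hd
      · have : q = 0 := by simpa using hq.symm
        subst this
        simpa using htD
      · rw [Function.update_of_ne hd.ne]
        refine hc0 (lt_min htD (Nat.pos_of_ne_zero ?_))
        rintro rfl
        have h0 := Finset.sum_eq_zero_iff.1 (hq.trans (mul_zero _)) 0 (Finset.mem_range.2 hd)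
        simp at h0
        omega

theorem sum_pow_sub_eq {ι : Type*} {s : Finset ι} {D H : ℕ} {m : ι → ℕ} (hD : 0 < D)
    (hm : ∀ x ∈ s, m x ≤ H) :
    ((∑ x ∈ s, (D : ℤ) ^ (H - m x) : ℤ) : ℝ) = (D : ℝ) ^ H * ∑ x ∈ s, ((D : ℝ)⁻¹) ^ m x := by
  push_cast
  rw [Finset.mul_sum]
  refine Finset.sum_congr rfl fun x hx => ?_
  rw [pow_sub₀ _ (by positivity) (hm x hx), inv_pow]

/-- Truncating the lengths of a complete code from below at `k` changes the scaled Kraft sum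
only by multiples of `(D - 1) * D ^ (H - k)`. -/
theorem dvd_sum_pow_sub_max_sub {ι : Type*} {s : Finset ι} {D H k : ℕ} {m : ι → ℕ} (hD : 0 < D)
    (hm : ∀ x ∈ s, m x ≤ H) (hk : k ≤ H) (hsum : ∑ x ∈ s, ((D : ℝ)⁻¹) ^ m x = 1) :
    (((D : ℤ) - 1) * (D : ℤ) ^ (H - k)) ∣
      ∑ x ∈ s, (D : ℤ) ^ (H - max (m x) k) - (D : ℤ) ^ (H - k) := by
  have key : ∀ c, c ≤ k → (((D : ℤ) - 1) * (D : ℤ) ^ (H - k)) ∣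
      (D : ℤ) ^ (H - c) - (D : ℤ) ^ (H - k) := by
    intro c hc
    have : H - c = (k - c) + (H - k) := by omega
    rw [this, pow_add, ← sub_one_mul]
    exact mul_dvd_mul_right (sub_one_dvd_pow_sub_one _ _) _
  have hZ : ∑ x ∈ s, (D : ℤ) ^ (H - m x) = (D : ℤ) ^ H := by
    have := sum_pow_sub_eq hD hm
    rw [hsum, mul_one] at this
    exact_mod_cast this
  have h1 : (((D : ℤ) - 1) * (D : ℤ) ^ (H - k)) ∣
      ∑ x ∈ s, ((D : ℤ) ^ (H - m x) - (D : ℤ) ^ (H - max (m x) k)) := by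
    refine Finset.dvd_sum fun x _ => ?_
    rcases le_total (m x) k with h | h
    · rw [max_eq_right h]; exact key _ h
    · rw [max_eq_left h, sub_self]; exact dvd_zero _
  rw [Finset.sum_sub_distrib, hZ] at h1
  have h2 := dvd_sub (key 0 (Nat.zero_le k)) h1
  rw [Nat.sub_zero] at h2
  exact h2.trans (dvd_of_eq (by ring))

/-- An incomplete code of a size `≡ 1 mod D - 1` has room to shorten one of its longest words. -/
theorem sum_inv_pow_add_le_one {ι : Type*} {s : Finset ι} {D M : ℕ} {l : ι → ℕ} (hD : 0 < D)
    (hmod : ((D : ℤ) - 1) ∣ (s.card : ℤ) - 1) (hl : ∀ x ∈ s, l x ≤ M)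
    (hlt : ∑ x ∈ s, ((D : ℝ)⁻¹) ^ l x < 1) :
    ∑ x ∈ s, ((D : ℝ)⁻¹) ^ l x + ((D : ℝ) - 1) * ((D : ℝ)⁻¹) ^ M ≤ 1 := by
  have hDM : (0 : ℝ) < (D : ℝ) ^ M := by positivity
  have hR := sum_pow_sub_eq hD hl
  have hdvd : ((D : ℤ) - 1) ∣ (D : ℤ) ^ M - ∑ x ∈ s, (D : ℤ) ^ (M - l x) := by
    have h1 : ((D : ℤ) - 1) ∣ ∑ x ∈ s, ((D : ℤ) ^ (M - l x) - 1) :=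
      Finset.dvd_sum fun x _ => sub_one_dvd_pow_sub_one _ _
    have h2 : ((D : ℤ) - 1) ∣ (D : ℤ) ^ M - 1 := sub_one_dvd_pow_sub_one _ _
    rw [Finset.sum_sub_distrib] at h1
    have h3 := dvd_sub (dvd_sub h2 h1) hmod
    rw [Finset.sum_const, nsmul_one] at h3
    exact h3.trans (dvd_of_eq (by ring))
  have hpos : 0 < (D : ℤ) ^ M - ∑ x ∈ s, (D : ℤ) ^ (M - l x) := by
    have : ((∑ x ∈ s, (D : ℤ) ^ (M - l x) : ℤ) : ℝ) < (((D : ℤ) ^ M : ℤ) : ℝ) := by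
      rw [hR]; push_cast; nlinarith
    exact sub_pos.2 (by exact_mod_cast this)
  have hle : (((D : ℤ) - 1 : ℤ) : ℝ) ≤
      (((D : ℤ) ^ M - ∑ x ∈ s, (D : ℤ) ^ (M - l x) : ℤ) : ℝ) :=
    Int.cast_le.2 (Int.le_of_dvd hpos hdvd)
  rw [Int.cast_sub, Int.cast_sub, hR] at hle
  push_cast at hle
  refine le_of_mul_le_mul_left ?_ hDM
  have : (D : ℝ) ^ M * ((D : ℝ)⁻¹) ^ M = 1 := by
    rw [inv_pow]; exact mul_inv_cancel₀ hDM.ne'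
  linear_combination hle + ((D : ℝ) - 1) * this

/-- The cells lying strictly between two complete codes, counted by level, have divisible
tails. -/
theorem pow_dvd_sum_card_cells {ι : Type*} {s : Finset ι} {D H j : ℕ} {l m : ι → ℕ}
    (hD : 2 ≤ D) (hl : ∀ x ∈ s, l x ≤ H + 1) (hm : ∀ x ∈ s, m x ≤ H)
    (hsl : ∑ x ∈ s, ((D : ℝ)⁻¹) ^ l x = 1) (hsm : ∑ x ∈ s, ((D : ℝ)⁻¹) ^ m x = 1)
    (hj : ∀ x ∈ s, j < m x → m x < l x) {k : ℕ} (hk : k ≤ H - j) (hjH : j ≤ H) :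
    D ^ k ∣ ∑ i ∈ Finset.range k,
      D ^ i * (s.filter fun x => m x < H - i ∧ H - i < l x).card := by
  have h1 := dvd_sum_pow_sub_max_sub (k := H - k) (by omega) hm (by omega) hsm
  have h2 := dvd_sum_pow_sub_max_sub (k := H - k + 1) (by omega) hl (by omega) hsl
  rw [show H + 1 - (H - k + 1) = k by omega] at h2
  rw [show H - (H - k) = k by omega] at h1
  have h3 := dvd_sub h1 h2
  have h4 : ((D : ℤ) - 1) * ∑ i ∈ Finset.range k,
        (D : ℤ) ^ i * ((s.filter fun x => m x < H - i ∧ H - i < l x).card : ℤ) =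
      ∑ x ∈ s, ((D : ℤ) ^ (H - max (m x) (H - k)) -
        (D : ℤ) ^ (H + 1 - max (l x) (H - k + 1))) := by
    simp_rw [Finset.card_filter]
    push_cast
    simp_rw [Finset.mul_sum]
    rw [Finset.sum_comm]
    refine Finset.sum_congr rfl fun x hx => ?_
    have hlx := hl x hx
    have hmx := hm x hx
    have hjx := hj x hx
    rw [← geom_sum_Ico_mul (D : ℤ) (by omega), ← Finset.mul_sum, mul_comm]
    congr 1
    simp_rw [mul_ite, mul_one, mul_zero]
    rw [← Finset.sum_filter]
    refine Finset.sum_congr ?_ fun _ _ => rfl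
    ext i
    simp only [Finset.mem_filter, Finset.mem_range, Finset.mem_Ico]
    omega
  have h5 : (((D : ℤ) - 1) * (D : ℤ) ^ k) ∣ ((D : ℤ) - 1) * ∑ i ∈ Finset.range k,
        (D : ℤ) ^ i * ((s.filter fun x => m x < H - i ∧ H - i < l x).card : ℤ) := by
    rw [h4, Finset.sum_sub_distrib]
    exact h3.trans (dvd_of_eq (by ring))
  have h6 := Int.dvd_of_mul_dvd_mul_left (by omega) h5
  exact_mod_cast h6

/-- Exchange between a complete code `l` of maximal length `H + 1` and a complete code `m` of
maximal length less than `H`: total lengths can be redistributed so that both codes have maximal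
length at most `H + 1` and `H`, and the second one attains `H` or is incomplete. -/
theorem exists_exchange {ι : Type*} {s : Finset ι} {D a H : ℕ} {l m : ι → ℕ}
    (hD : 2 ≤ D) (hla : ∀ x ∈ s, a ≤ l x) (hl : ∀ x ∈ s, l x ≤ H + 1)
    (hma : ∀ x ∈ s, a ≤ m x) (hm : ∀ x ∈ s, m x < H)
    (hsl : ∑ x ∈ s, ((D : ℝ)⁻¹) ^ l x = 1) (hsm : ∑ x ∈ s, ((D : ℝ)⁻¹) ^ m x = 1)
    (hmax : ∃ x ∈ s, l x = H + 1) :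
    ∃ l' m' : ι → ℕ, (∀ x ∈ s, l' x + m' x = l x + m x) ∧
      (∀ x ∈ s, a ≤ l' x ∧ l' x ≤ H + 1) ∧ (∀ x ∈ s, a ≤ m' x ∧ m' x ≤ H) ∧
      ∑ x ∈ s, ((D : ℝ)⁻¹) ^ l' x ≤ 1 ∧ ∑ x ∈ s, ((D : ℝ)⁻¹) ^ m' x ≤ 1 ∧
      ((∃ x ∈ s, m' x = H) ∨ ∑ x ∈ s, ((D : ℝ)⁻¹) ^ m' x < 1) := by
  classical
  obtain ⟨x₀, hx₀, hx₀l⟩ := hmax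
  have hDR : (2 : ℝ) ≤ D := by exact_mod_cast hD
  set r : ℝ := (D : ℝ)⁻¹ with hrdef
  have hr : 0 < r := by positivity
  have hDr : (D : ℝ) * r = 1 := mul_inv_cancel₀ (by positivity)
  have hr1 : r < 1 := by nlinarith
  obtain ⟨y, hy, hyl⟩ : ∃ y ∈ s, l y < m y := by
    by_contra! hcon
    have : ∑ x ∈ s, r ^ l x < ∑ x ∈ s, r ^ m x :=
      Finset.sum_lt_sum (fun x hx => pow_le_pow_of_le_one hr.le hr1.le (hcon x hx))
        ⟨x₀, hx₀, pow_lt_pow_right_of_lt_one₀ hr hr1 (by have := hm x₀ hx₀; omega)⟩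
    linarith
  obtain ⟨z, hz, hzmax⟩ := Finset.exists_max_image (s.filter fun x => l x ≤ m x) m
    ⟨y, Finset.mem_filter.2 ⟨hy, hyl.le⟩⟩
  obtain ⟨hzs, hzl⟩ := Finset.mem_filter.1 hz
  obtain ⟨j, hj⟩ : ∃ j, m z = j := ⟨_, rfl⟩
  have haj : a < j := by
    have := hzmax y (Finset.mem_filter.2 ⟨hy, hyl.le⟩)
    have := hla y hy
    omega
  have hjH : j < H := hj ▸ hm z hzs
  have hcell : ∀ x ∈ s, j < m x → m x < l x := by
    intro x hx hjx
    by_contra! hcon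
    have := hzmax x (Finset.mem_filter.2 ⟨hx, hcon⟩)
    omega
  set B : ℕ → Finset ι := fun i => s.filter fun x => m x < H - i ∧ H - i < l x with hB
  have hdvd : ∀ k ≤ H - j, D ^ k ∣ ∑ i ∈ Finset.range k, D ^ i * (B i).card := fun k hk =>
    pow_dvd_sum_card_cells hD hl (fun x hx => (hm x hx).le) hsl hsm hcell hk hjH.le
  have hB0 : 0 < (B 0).card := by
    refine Finset.card_pos.2 ⟨x₀, Finset.mem_filter.2 ⟨hx₀, ?_⟩⟩
    have := hm x₀ hx₀
    omega
  obtain ⟨c, hcB, hcsum, hc0⟩ := exists_le_sum_pow_mul_eq (by omega) (fun i => (B i).card) hB0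
    (H - j) hdvd 1 (by
      rw [one_mul]
      refine Nat.le_of_dvd ?_ (hdvd _ le_rfl)
      refine Finset.sum_pos' (fun _ _ => Nat.zero_le _) ⟨0, Finset.mem_range.2 (by omega), ?_⟩
      simpa using hB0)
  have hX : ∀ i, ∃ X ⊆ B i, X.card = c i := fun i => Finset.exists_subset_card_eq (hcB i)
  choose X hXB hXc using hX
  set Y : ι → Finset ℕ := fun x => (Finset.Ioc j H).filter fun e => x ∈ X (H - e) with hY
  have hYmem : ∀ x, ∀ e ∈ Y x, m x < e ∧ e < l x ∧ e ≤ H := by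
    intro x e he
    obtain ⟨he1, he2⟩ := Finset.mem_filter.1 he
    have he3 := (Finset.mem_filter.1 (hXB _ he2)).2
    have he4 := Finset.mem_Ioc.1 he1
    rw [Nat.sub_sub_self he4.2] at he3
    exact ⟨he3.1, he3.2, he4.2⟩
  have hYl : ∀ x, (Y x).card ≤ l x - m x - 1 := by
    intro x
    rw [← Nat.card_Ioo]
    exact Finset.card_le_card fun e he =>
      Finset.mem_Ioo.2 ⟨(hYmem x e he).1, (hYmem x e he).2.1⟩
  have hYz : Y z = ∅ := by
    rw [← Finset.card_eq_zero]
    have := hYl z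
    omega
  have hYsum : ∑ x ∈ s, ∑ e ∈ Y x, r ^ e = r ^ j := by
    have h1 : ∑ x ∈ s, ∑ e ∈ Y x, r ^ e = ∑ e ∈ Finset.Ioc j H, (c (H - e) : ℝ) * r ^ e := by
      simp_rw [hY, Finset.sum_filter]
      rw [Finset.sum_comm]
      refine Finset.sum_congr rfl fun e _ => ?_
      rw [← Finset.sum_filter, Finset.sum_const, nsmul_eq_mul, Finset.filter_mem_eq_inter,
        Finset.inter_eq_right.2 ((hXB _).trans (Finset.filter_subset _ _)), hXc]
    have h2 : ∑ e ∈ Finset.Ioc j H, (c (H - e) : ℝ) * r ^ e =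
        ∑ i ∈ Finset.range (H - j), r ^ H * ((D : ℝ) ^ i * c i) := by
      refine Finset.sum_nbij' (fun e => H - e) (fun i => H - i) ?_ ?_ ?_ ?_ ?_
      · intro e he; have := Finset.mem_Ioc.1 he; exact Finset.mem_range.2 (by omega)
      · intro i hi; have := Finset.mem_range.1 hi; exact Finset.mem_Ioc.2 (by omega)
      · intro e he; have := Finset.mem_Ioc.1 he; omega
      · intro i hi; have := Finset.mem_range.1 hi; omega
      · intro e he
        have he' := Finset.mem_Ioc.1 he
        have h3 : r ^ H = r ^ e * r ^ (H - e) := by rw [← pow_add]; congr 1; omega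
        have h4 : r ^ (H - e) * (D : ℝ) ^ (H - e) = 1 := by
          rw [← mul_pow, mul_comm, hDr, one_pow]
        rw [h3]
        linear_combination -(r ^ e * c (H - e)) * h4
    have h5 : ∑ i ∈ Finset.range (H - j), (D : ℝ) ^ i * c i = (D : ℝ) ^ (H - j) := by
      rw [one_mul] at hcsum
      exact_mod_cast hcsum
    have h6 : r ^ H = r ^ j * r ^ (H - j) := by rw [← pow_add]; congr 1; omega
    rw [h1, h2, ← Finset.mul_sum, h5, h6, mul_assoc, ← mul_pow, mul_comm r, hDr, one_pow, mul_one]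
  have hδ : ∀ q : ℝ, ∑ x ∈ s, (if x = z then q else 0) = q := fun q => by simp [hzs]
  obtain ⟨x₁, hx₁⟩ : (X 0).Nonempty := Finset.card_pos.1 (by rw [hXc]; exact hc0 one_pos)
  have hx₁Y : H ∈ Y x₁ := Finset.mem_filter.2 ⟨Finset.mem_Ioc.2 ⟨hjH, le_rfl⟩, by simpa using hx₁⟩
  have hx₁s : x₁ ∈ s := (Finset.mem_filter.1 (hXB _ hx₁)).1
  have hx₁z : x₁ ≠ z := by rintro rfl; simp [hYz] at hx₁Y
  let l' : ι → ℕ := fun x => if x = z then l x + 1 else l x - (Y x).card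
  let m' : ι → ℕ := fun x => if x = z then m x - 1 else m x + (Y x).card
  have hm'le : ∀ x ∈ s, r ^ m' x ≤
      r ^ m x - (D - 1) * ∑ e ∈ Y x, r ^ e + if x = z then (D - 1) * r ^ j else 0 := by
    intro x _
    by_cases hxz : x = z
    · subst hxz
      obtain ⟨i, rfl⟩ : ∃ i, j = i + 1 := ⟨j - 1, by omega⟩
      simp only [m', if_true, hYz, hj, Finset.sum_empty, Nat.add_sub_cancel, pow_succ]
      apply le_of_eq
      linear_combination -(r ^ i) * hDr
    · simp only [m', if_neg hxz]
      linarith [mul_sum_pow_add_pow_card_le (by linarith) hr hDr (m x) (Y x)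
        fun e he => (hYmem x e he).1]
  have hm'tot : ∑ x ∈ s, (r ^ m x - (D - 1) * ∑ e ∈ Y x, r ^ e +
      if x = z then (D - 1) * r ^ j else 0) = 1 := by
    rw [Finset.sum_add_distrib, Finset.sum_sub_distrib, ← Finset.mul_sum, hδ, hsm, hYsum]
    ring
  refine ⟨l', m', ?_, ?_, ?_, ?_, ?_, ?_⟩
  · intro x _
    have := hYl x
    simp only [l', m']
    split_ifs with h
    · subst h; omega
    · omega
  · intro x hx
    have := hYl x
    have := hla x hx
    have := hl x hx
    have := hma x hx
    simp only [l']
    split_ifs with h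
    · subst h; omega
    · omega
  · intro x hx
    have := hYl x
    have := hl x hx
    have := hma x hx
    have := hm x hx
    simp only [m']
    split_ifs with h
    · subst h; omega
    · omega
  · have h1 : ∀ x ∈ s, r ^ l' x ≤ r ^ l x + (D - 1) * r * ∑ e ∈ Y x, r ^ e -
        if x = z then (D - 1) * r * r ^ j else 0 := by
      intro x _
      by_cases hxz : x = z
      · subst hxz
        simp only [l', if_true, hYz, Finset.sum_empty, pow_succ]
        have h2 : r ^ j ≤ r ^ l x := pow_le_pow_of_le_one hr.le hr1.le (by omega)
        have h3 : 0 ≤ ((D : ℝ) - 1) * r := mul_nonneg (by linarith) hr.le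
        have h4 := mul_le_mul_of_nonneg_left h2 h3
        linear_combination h4 + r ^ l x * hDr
      · simp only [l', if_neg hxz, sub_zero]
        exact pow_sub_card_le (by linarith) hr hDr (l x) (Y x) fun e he => (hYmem x e he).2.1
    refine (Finset.sum_le_sum h1).trans (le_of_eq ?_)
    rw [Finset.sum_sub_distrib, Finset.sum_add_distrib, ← Finset.mul_sum, hδ, hsl, hYsum]
    ring
  · exact (Finset.sum_le_sum hm'le).trans hm'tot.le
  · by_cases hx₁H : m' x₁ = H
    · exact Or.inl ⟨x₁, hx₁s, hx₁H⟩
    · right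
      refine (Finset.sum_lt_sum hm'le ⟨x₁, hx₁s, ?_⟩).trans_le hm'tot.le
      simp only [m', if_neg hx₁z] at hx₁H ⊢
      have := hYl x₁
      have := hl x₁ hx₁s
      have := hm x₁ hx₁s
      linarith [mul_sum_pow_add_pow_card_lt (by linarith) hr hDr (Y x₁)
        (fun e he => (hYmem x₁ e he).1) hx₁Y (by omega)]

/-- Optimal codes of a size `≡ 1 mod D - 1` are complete. -/
theorem kraft_eq_one_of_forall_linPenalty_le {D n a b : ℕ} {p : ℕ → ℝ} {l : ℕ → ℕ} (hD : 2 ≤ D)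
    (hn : D ^ a < n) (hmod : (D - 1) ∣ (n - 1)) (hp : ∀ i ∈ Finset.Icc 1 n, 0 < p i)
    (hl : ∀ i ∈ Finset.Icc 1 n, a ≤ l i ∧ l i ≤ b) (hk : kraft D n l ≤ 1)
    (hmin : ∀ l' : ℕ → ℕ, (∀ i ∈ Finset.Icc 1 n, a ≤ l' i ∧ l' i ≤ b) →
      kraft D n l' ≤ 1 → linPenalty n p l ≤ linPenalty n p l') :
    kraft D n l = 1 := by
  by_contra hne
  have hlt : ∑ i ∈ Finset.Icc 1 n, ((D : ℝ)⁻¹) ^ l i < 1 :=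
    kraft_eq_sum_inv_pow D n l ▸ lt_of_le_of_ne hk hne
  have hn0 : 0 < n := by omega
  have hDR : (2 : ℝ) ≤ D := by exact_mod_cast hD
  obtain ⟨z, hz, hzmax⟩ := Finset.exists_max_image (Finset.Icc 1 n) l
    ⟨1, Finset.mem_Icc.2 ⟨le_rfl, hn0⟩⟩
  have hza : a < l z := by
    by_contra! hcon
    have h1 : ∑ i ∈ Finset.Icc 1 n, ((D : ℝ)⁻¹) ^ l i = n * ((D : ℝ)⁻¹) ^ a := by
      rw [Finset.sum_congr rfl fun i hi => by
        rw [show l i = a from ((hzmax i hi).trans hcon).antisymm (hl i hi).1]]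
      simp
    rw [h1, inv_pow, ← div_eq_mul_inv, div_lt_one (by positivity)] at hlt
    have : n < D ^ a := by exact_mod_cast hlt
    omega
  have hmodZ : ((D : ℤ) - 1) ∣ ((Finset.Icc 1 n).card : ℤ) - 1 := by
    have := Int.natCast_dvd_natCast.2 hmod
    rw [Nat.cast_sub (by omega), Nat.cast_sub (by omega)] at this
    simpa using this
  have hroom := sum_inv_pow_add_le_one (by omega) hmodZ hzmax hlt
  have hle := hmin (Function.update l z (l z - 1)) (fun i hi => by
    by_cases h : i = z
    · subst h
      have := hl i hi
      simp only [Function.update_self]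
      omega
    · simpa [h] using hl i hi) (by
    rw [kraft_eq_sum_inv_pow]
    refine le_trans (le_of_eq ?_) hroom
    rw [← Finset.add_sum_erase _ _ hz, ← Finset.add_sum_erase _ _ hz, Function.update_self,
      Finset.sum_congr rfl fun i hi => by
        rw [Function.update_of_ne (Finset.ne_of_mem_erase hi)]]
    obtain ⟨k, hk⟩ : ∃ k, l z = k + 1 := ⟨l z - 1, by omega⟩
    rw [hk, Nat.add_sub_cancel, pow_succ]
    have : (D : ℝ) * (D : ℝ)⁻¹ = 1 := mul_inv_cancel₀ (by positivity)
    linear_combination -(((D : ℝ)⁻¹) ^ k) * this)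
  refine absurd hle (not_le.2 (Finset.sum_lt_sum (fun i hi => ?_) ⟨z, hz, ?_⟩))
  · refine mul_le_mul_of_nonneg_left ?_ (hp i hi).le
    by_cases h : i = z
    · subst h; simp
    · simp [h]
  · refine mul_lt_mul_of_pos_left ?_ (hp z hz)
    rw [Function.update_self]
    exact_mod_cast (by omega : l z - 1 < l z)

theorem exists_forall_linPenalty_le {D n a b : ℕ} (p : ℕ → ℝ) (hD : 0 < D) (hab : a ≤ b)
    (hn : n ≤ D ^ b) :
    ∃ l : ℕ → ℕ, (∀ i ∈ Finset.Icc 1 n, a ≤ l i ∧ l i ≤ b) ∧ kraft D n l ≤ 1 ∧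
      ∀ l' : ℕ → ℕ, (∀ i ∈ Finset.Icc 1 n, a ≤ l' i ∧ l' i ≤ b) →
        kraft D n l' ≤ 1 → linPenalty n p l ≤ linPenalty n p l' := by
  classical
  let ext : (Finset.Icc 1 n → Fin (b + 1)) → ℕ → ℕ := fun g i =>
    if h : i ∈ Finset.Icc 1 n then g ⟨i, h⟩ else 0
  let F : Set (Finset.Icc 1 n → Fin (b + 1)) :=
    {g | (∀ i ∈ Finset.Icc 1 n, a ≤ ext g i) ∧ kraft D n (ext g) ≤ 1}
  have hext : ∀ l : ℕ → ℕ, (∀ i ∈ Finset.Icc 1 n, l i ≤ b) →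
      ∃ g, ∀ i ∈ Finset.Icc 1 n, ext g i = l i := fun l hl =>
    ⟨fun i => ⟨l i, Nat.lt_succ_of_le (hl i i.2)⟩, fun i hi => by simp only [ext, dif_pos hi]⟩
  have hkr : ∀ l l' : ℕ → ℕ, (∀ i ∈ Finset.Icc 1 n, l i = l' i) → kraft D n l = kraft D n l' :=
    fun l l' h => Finset.sum_congr rfl fun i hi => by rw [h i hi]
  have hF : F.Nonempty := by
    obtain ⟨g, hg⟩ := hext (fun _ => b) fun _ _ => le_rfl
    refine ⟨g, fun i hi => (hg i hi).symm ▸ hab, ?_⟩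
    rw [hkr _ _ hg, kraft_eq_sum_inv_pow]
    simp only [Finset.sum_const, Nat.card_Icc, Nat.add_sub_cancel, nsmul_eq_mul, inv_pow]
    rw [← div_eq_mul_inv, div_le_one (by positivity)]
    exact_mod_cast hn
  obtain ⟨g, hg, hgmin⟩ := Set.exists_min_image F (fun g => linPenalty n p (ext g))
    (Set.toFinite F) hF
  refine ⟨ext g, fun i hi => ⟨hg.1 i hi, ?_⟩, hg.2, fun l' hl' hk' => ?_⟩
  · simp only [ext, dif_pos hi]
    exact Nat.lt_succ_iff.1 (g ⟨i, hi⟩).2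
  · obtain ⟨g', hg'⟩ := hext l' fun i hi => (hl' i hi).2
    have hpen : linPenalty n p (ext g') = linPenalty n p l' :=
      Finset.sum_congr rfl fun i hi => by rw [hg' i hi]
    rw [← hpen]
    exact hgmin g' ⟨fun i hi => (hg' i hi).symm ▸ (hl' i hi).1, (hkr _ _ hg').trans_le hk'⟩

/-- For the linear penalty and assuming n ≤ D^{l_max−1}: if some length
vector minimizing Σ p_i·l_i among feasible length vectors with entries in
[l_min, l_max] has maximum entry l_max, then some length vector minimizing Σ p_i·l_i
among feasible length vectors with entries in [l_min, l_max−1] has maximum entry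
l_max−1. -/
theorem statement6 (D lmin lmax n : ℕ) (hD : 2 ≤ D) (hlm : lmin < lmax)
    (hn1 : D ^ lmin < n) (hn2 : n ≤ D ^ lmax) (hmod : (D - 1) ∣ (n - 1))
    (p : ℕ → ℝ) (hppos : ∀ i ∈ Finset.Icc 1 n, 0 < p i)
    (hpdec : ∀ i ∈ Finset.Icc 1 n, ∀ j ∈ Finset.Icc 1 n, i ≤ j → p j ≤ p i)
    (hsmall : n ≤ D ^ (lmax - 1))
    (hex : ∃ l : ℕ → ℕ,
      (∀ i ∈ Finset.Icc 1 n, lmin ≤ l i ∧ l i ≤ lmax) ∧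
      kraft D n l ≤ 1 ∧
      (∀ l' : ℕ → ℕ, (∀ i ∈ Finset.Icc 1 n, lmin ≤ l' i ∧ l' i ≤ lmax) →
        kraft D n l' ≤ 1 → linPenalty n p l ≤ linPenalty n p l') ∧
      (∃ i ∈ Finset.Icc 1 n, l i = lmax)) :
    ∃ l : ℕ → ℕ,
      (∀ i ∈ Finset.Icc 1 n, lmin ≤ l i ∧ l i ≤ lmax - 1) ∧
      kraft D n l ≤ 1 ∧
      (∀ l' : ℕ → ℕ, (∀ i ∈ Finset.Icc 1 n, lmin ≤ l' i ∧ l' i ≤ lmax - 1) →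
        kraft D n l' ≤ 1 → linPenalty n p l ≤ linPenalty n p l') ∧
      (∃ i ∈ Finset.Icc 1 n, l i = lmax - 1) := by
  obtain ⟨H, rfl⟩ : ∃ H, lmax = H + 1 := ⟨lmax - 1, by omega⟩
  simp only [Nat.add_sub_cancel] at hsmall ⊢
  obtain ⟨l, hl, hlk, hlmin, hlmax⟩ := hex
  obtain ⟨m, hm, hmk, hmmin⟩ :=
    exists_forall_linPenalty_le p (by omega : 0 < D) (Nat.lt_succ_iff.1 hlm) hsmall
  by_cases hmH : ∃ i ∈ Finset.Icc 1 n, m i = H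
  · exact ⟨m, hm, hmk, hmmin, hmH⟩
  push Not at hmH
  have hl1 := kraft_eq_one_of_forall_linPenalty_le hD hn1 hmod hppos hl hlk hlmin
  have hm1 := kraft_eq_one_of_forall_linPenalty_le hD hn1 hmod hppos hm hmk hmmin
  rw [kraft_eq_sum_inv_pow] at hl1 hm1
  obtain ⟨l', m', hsum, hl', hm', hl'k, hm'k, hm'H⟩ := exists_exchange hD
    (fun i hi => (hl i hi).1) (fun i hi => (hl i hi).2) (fun i hi => (hm i hi).1)
    (fun i hi => lt_of_le_of_ne (hm i hi).2 (hmH i hi)) hl1 hm1 hlmax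
  rw [← kraft_eq_sum_inv_pow] at hl'k hm'k hm'H
  have hpen : linPenalty n p l' + linPenalty n p m' = linPenalty n p l + linPenalty n p m := by
    simp only [linPenalty, ← Finset.sum_add_distrib, ← mul_add]
    refine Finset.sum_congr rfl fun i hi => ?_
    have : (l' i : ℝ) + m' i = l i + m i := by exact_mod_cast hsum i hi
    rw [this]
  have hle := hlmin l' hl' hl'k
  have hm'min : ∀ q : ℕ → ℕ, (∀ i ∈ Finset.Icc 1 n, lmin ≤ q i ∧ q i ≤ H) →
      kraft D n q ≤ 1 → linPenalty n p m' ≤ linPenalty n p q := fun q hq hqk => by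
    linarith [hmmin q hq hqk]
  refine ⟨m', hm', hm'k, hm'min, hm'H.resolve_right ?_⟩
  exact (kraft_eq_one_of_forall_linPenalty_le hD hn1 hmod hppos hm' hm'k hm'min).not_lt
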